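/- Let p and q be probability measures on ℝ^d with p absolutely continuous with respect to q. Then the function α ↦ KKL_α(p||q) is decreasing on the interval [0,1]. -/

import Mathlib

open MeasureTheory RealInnerProductSpace
open scoped ENNReal

noncomputable section

/-- Rank-one operator `u v^*` : `f ↦ ⟪v, f⟫ • u`. -/
def rankOne {H : Type*} [NormedAddCommGroup H] [InnerProductSpace ℝ H] (u v : H) :
    H →L[ℝ] H := (innerSL ℝ v).smulRight u

/-- Covariance operator `Σ_p = ∫ φ(x) ⊗ φ(x) dp(x)` of the measure `p` with respect to
the feature map `φ`. -/
def covOp {d : ℕ} {H : Type*} [NormedAddCommGroup H] [InnerProductSpace ℝ H]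
    [CompleteSpace H] (φ : EuclideanSpace ℝ (Fin d) → H)
    (p : Measure (EuclideanSpace ℝ (Fin d))) : H →L[ℝ] H :=
  ∫ x, rankOne (φ x) (φ x) ∂p

lemma aux_int_nonneg (c l : ℝ) (hc : 0 < c) (hcl : c ≤ l) :
    IntegrableOn (fun s : ℝ => 1 / (c + s) - 1 / (l + s)) (Set.Ioi 0) ∧
    ∫ s in Set.Ioi (0:ℝ), (1 / (c + s) - 1 / (l + s)) = Real.log (l / c) := by
  have hl : 0 < l := lt_of_lt_of_le hc hcl
  have hderiv : ∀ x ∈ Set.Ici (0:ℝ), HasDerivAt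
      (fun s : ℝ => Real.log (c + s) - Real.log (l + s)) (1 / (c + x) - 1 / (l + x)) x := by
    intro x hx
    have hx : 0 ≤ x := hx
    exact (((hasDerivAt_id x).const_add c).log (by simp; linarith)).sub
      (((hasDerivAt_id x).const_add l).log (by simp; linarith))
  have hpos : ∀ x ∈ Set.Ioi (0:ℝ), 0 ≤ 1 / (c + x) - 1 / (l + x) := by
    intro x hx
    have hx : 0 < x := hx
    rw [sub_nonneg]
    exact one_div_le_one_div_of_le (by linarith) (by linarith)
  have hlim : Filter.Tendsto (fun s : ℝ => Real.log (c + s) - Real.log (l + s)) Filter.atTop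
      (nhds 0) := by
    have h1 : Filter.Tendsto (fun s : ℝ => 1 + (c - l) / (l + s)) Filter.atTop
        (nhds (1 + 0)) := by
      refine tendsto_const_nhds.add ?_
      exact Filter.Tendsto.div_atTop tendsto_const_nhds
        (Filter.tendsto_atTop_add_const_left _ _ Filter.tendsto_id)
    have h2 := (Real.continuousAt_log (x := 1 + 0) (by norm_num)).tendsto.comp h1
    simp only [add_zero, Real.log_one] at h2
    refine h2.congr' ?_
    filter_upwards [Filter.eventually_gt_atTop (0:ℝ)] with s hs
    rw [← Real.log_div (by linarith) (by linarith)]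
    simp only [Function.comp]
    congr 1
    have : l + s ≠ 0 := by linarith
    field_simp
    ring
  refine ⟨integrableOn_Ioi_deriv_of_nonneg' hderiv hpos hlim, ?_⟩
  rw [integral_Ioi_of_hasDerivAt_of_nonneg' hderiv hpos hlim, Real.log_div hl.ne' hc.ne']
  simp

/-- Integral representation of the logarithm. -/
lemma aux_int (c l : ℝ) (hc : 0 < c) (hl : 0 < l) :
    IntegrableOn (fun s : ℝ => 1 / (c + s) - 1 / (l + s)) (Set.Ioi 0) ∧
    ∫ s in Set.Ioi (0:ℝ), (1 / (c + s) - 1 / (l + s)) = Real.log (l / c) ∧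
    ∫ s in Set.Ioi (0:ℝ), ‖1 / (c + s) - 1 / (l + s)‖ = |Real.log (l / c)| := by
  rcases le_total c l with h | h
  · obtain ⟨h1, h2⟩ := aux_int_nonneg c l hc h
    refine ⟨h1, h2, ?_⟩
    rw [abs_of_nonneg (Real.log_nonneg ((one_le_div hc).2 h)), ← h2]
    refine setIntegral_congr_fun measurableSet_Ioi fun s hs => ?_
    have hs : 0 < s := hs
    have : 1 / (l + s) ≤ 1 / (c + s) := one_div_le_one_div_of_le (by linarith) (by linarith)
    simp only [Real.norm_eq_abs]
    rw [abs_of_nonneg (by linarith)]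
  · obtain ⟨h1, h2⟩ := aux_int_nonneg l c hl h
    have e : (fun s : ℝ => 1 / (c + s) - 1 / (l + s)) =
        fun s => -(1 / (l + s) - 1 / (c + s)) := by ext s; ring
    have e3 : Real.log (l / c) = - Real.log (c / l) := by
      rw [← Real.log_inv, inv_div]
    refine ⟨?_, ?_, ?_⟩
    · rw [e]; exact h1.neg
    · rw [e, integral_neg, h2, e3]
    · rw [e3, abs_neg, abs_of_nonneg (Real.log_nonneg ((one_le_div hl).2 h)), ← h2]
      refine setIntegral_congr_fun measurableSet_Ioi fun s hs => ?_
      have hs : 0 < s := hs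
      have : 1 / (c + s) ≤ 1 / (l + s) := one_div_le_one_div_of_le (by linarith) (by linarith)
      simp only [Real.norm_eq_abs]
      rw [abs_of_nonpos (by linarith)]
      ring

lemma aux_summable_div {ι : Type*} (w c : ι → ℝ) (hw : ∀ j, 0 ≤ w j) (hc : ∀ j, 0 ≤ c j)
    (hs : Summable w) {s : ℝ} (h : 0 < s) : Summable (fun j => w j / (c j + s)) := by
  refine Summable.of_nonneg_of_le (fun j => ?_) (fun j => ?_) (hs.div_const s)
  · have := hw j; have := hc j; positivity
  · exact div_le_div_of_nonneg_left (hw j) h (by linarith [hc j])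

/-- Scalar comparison: an inequality between resolvent traces gives one between log traces. -/
lemma aux_key {ι : Type*} (w1 w2 c1 c2 : ι → ℝ) (l t : ℝ) (hl : 0 < l) (ht1 : t ≤ 1)
    (hw1 : ∀ j, 0 ≤ w1 j) (hw2 : ∀ j, 0 ≤ w2 j) (hc1 : ∀ j, 0 ≤ c1 j) (hc2 : ∀ j, 0 ≤ c2 j)
    (hs1 : HasSum w1 1) (hs2 : HasSum w2 1)
    (hz1 : ∀ j, c1 j = 0 → w1 j = 0) (hz2 : ∀ j, c2 j = 0 → w2 j = 0)
    (hS1 : Summable (fun j => Real.log (l / c1 j) * w1 j))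
    (hS2 : Summable (fun j => Real.log (l / c2 j) * w2 j))
    (hR : ∀ s : ℝ, 0 < s → ∑' j, w2 j / (c2 j + s) ≤
      (1 - t) * ∑' j, w1 j / (c1 j + s) + t * (1 / (l + s))) :
    ∑' j, Real.log (l / c2 j) * w2 j ≤ (1 - t) * ∑' j, Real.log (l / c1 j) * w1 j := by
  have hrep : ∀ (w c : ι → ℝ), (∀ j, 0 ≤ w j) → (∀ j, 0 ≤ c j) → (∀ j, c j = 0 → w j = 0) →
      ∀ j, IntegrableOn (fun s : ℝ => (1 / (c j + s) - 1 / (l + s)) * w j) (Set.Ioi 0) ∧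
      ∫ s in Set.Ioi (0:ℝ), (1 / (c j + s) - 1 / (l + s)) * w j = Real.log (l / c j) * w j ∧
      ∫ s in Set.Ioi (0:ℝ), ‖(1 / (c j + s) - 1 / (l + s)) * w j‖
        = |Real.log (l / c j) * w j| := by
    intro w c hw hc hz j
    rcases (hc j).eq_or_lt with h | h
    · simp [hz j h.symm]
    · obtain ⟨a1, a2, a3⟩ := aux_int (c j) l h hl
      refine ⟨a1.mul_const _, ?_, ?_⟩
      · rw [integral_mul_const, a2]
      · simp_rw [norm_mul]
        rw [integral_mul_const, a3, abs_mul, Real.norm_eq_abs]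
  set J : Set ι := Function.support w1 ∪ Function.support w2 with hJ
  have hJc : J.Countable := hs1.summable.countable_support.union hs2.summable.countable_support
  have : Countable J := hJc.to_subtype
  have hn1 : ∀ j, j ∉ J → w1 j = 0 := fun j hj => by
    by_contra h; exact hj (Or.inl h)
  have hn2 : ∀ j, j ∉ J → w2 j = 0 := fun j hj => by
    by_contra h; exact hj (Or.inr h)
  let K : ι → ℝ → ℝ := fun j s => (1 - t) * ((1 / (c1 j + s) - 1 / (l + s)) * w1 j) -
    (1 / (c2 j + s) - 1 / (l + s)) * w2 j
  have r1 := hrep w1 c1 hw1 hc1 hz1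
  have r2 := hrep w2 c2 hw2 hc2 hz2
  have hKint : ∀ j, IntegrableOn (K j) (Set.Ioi 0) := fun j =>
    ((r1 j).1.const_mul _).sub (r2 j).1
  have hKeq : ∀ j, ∫ s in Set.Ioi (0:ℝ), K j s =
      (1 - t) * (Real.log (l / c1 j) * w1 j) - Real.log (l / c2 j) * w2 j := by
    intro j
    simp only [K]
    rw [integral_sub ((r1 j).1.const_mul _) (r2 j).1, integral_const_mul, (r1 j).2.1, (r2 j).2.1]
  have hKn : ∀ j, ∫ s in Set.Ioi (0:ℝ), ‖K j s‖ ≤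
      (1 - t) * |Real.log (l / c1 j) * w1 j| + |Real.log (l / c2 j) * w2 j| := by
    intro j
    rw [← (r1 j).2.2, ← (r2 j).2.2, ← integral_const_mul,
      ← integral_add ((r1 j).1.norm.const_mul _) (r2 j).1.norm]
    refine integral_mono (hKint j).norm
      (((r1 j).1.norm.const_mul _).add (r2 j).1.norm) fun s => ?_
    refine (norm_sub_le _ _).trans ?_
    rw [norm_mul (1 - t), Real.norm_of_nonneg (by linarith : 0 ≤ 1 - t)]
  have hKs : Summable (fun j : ι => ∫ s in Set.Ioi (0:ℝ), ‖K j s‖) := by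
    refine Summable.of_nonneg_of_le (fun j => integral_nonneg fun s => norm_nonneg _) hKn ?_
    exact (hS1.abs.mul_left _).add hS2.abs
  have hmain := hasSum_integral_of_summable_integral_norm (μ := volume.restrict (Set.Ioi (0:ℝ)))
    (F := fun (j : J) => K j) (fun j => hKint j) (hKs.comp_injective Subtype.val_injective)
  have hK0 : ∀ s, ∑' j : J, K j s = ∑' j, K j s := by
    intro s
    refine tsum_subtype_eq_of_support_subset (f := fun j => K j s) fun j hj => ?_
    by_contra h
    exact hj (by simp [K, hn1 j h, hn2 j h])
  have hnn : 0 ≤ ∫ s in Set.Ioi (0:ℝ), ∑' j : J, K j s := by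
    refine setIntegral_nonneg measurableSet_Ioi fun s hs => ?_
    have hs : 0 < s := hs
    rw [hK0]
    have d1 := aux_summable_div w1 c1 hw1 hc1 hs1.summable hs
    have d2 := aux_summable_div w2 c2 hw2 hc2 hs2.summable hs
    have H := ((d1.hasSum.sub (hs1.mul_left (1 / (l + s)))).mul_left (1 - t)).sub
      (d2.hasSum.sub (hs2.mul_left (1 / (l + s))))
    have e : (fun j => K j s) = fun j => (1 - t) * (w1 j / (c1 j + s) - 1 / (l + s) * w1 j) -
        (w2 j / (c2 j + s) - 1 / (l + s) * w2 j) := by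
      ext j; simp only [K]; ring
    rw [e, H.tsum_eq]
    have := hR s hs
    linarith
  have hfin := hmain.tsum_eq
  have hle : 0 ≤ ∑' j : J, ∫ s in Set.Ioi (0:ℝ), K j s := by rw [hfin]; exact hnn
  have e2 : ∑' j : J, ∫ s in Set.Ioi (0:ℝ), K j s = ∑' j, ∫ s in Set.Ioi (0:ℝ), K j s := by
    refine tsum_subtype_eq_of_support_subset
      (f := fun j => ∫ s in Set.Ioi (0:ℝ), K j s) fun j hj => ?_
    by_contra h
    exact hj (by simp [K, hn1 j h, hn2 j h])
  rw [e2] at hle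
  simp_rw [hKeq] at hle
  rw [((hS1.hasSum.mul_left (1 - t)).sub hS2.hasSum).tsum_eq] at hle
  linarith

/-! Spectral part -/

section spec
variable {H : Type*} [NormedAddCommGroup H] [InnerProductSpace ℝ H] {ι : Type*}

lemma aux_hasSum_sq (b : HilbertBasis ι ℝ H) (v : H) :
    HasSum (fun j => ⟪v, b j⟫ ^ 2) (‖v‖ ^ 2) := by
  have h := b.hasSum_inner_mul_inner v v
  rw [real_inner_self_eq_norm_sq] at h
  refine h.congr_fun fun j => ?_
  rw [real_inner_comm v (b j), sq]

lemma aux_hasSum_quad (b : HilbertBasis ι ℝ H) (X : H →L[ℝ] H) (c : ι → ℝ)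
    (hX : ∀ j, X (b j) = c j • b j) (w : H) :
    HasSum (fun j => c j * ⟪w, b j⟫ ^ 2) ⟪w, X w⟫ := by
  have h := ((b.hasSum_repr w).mapL X).mapL (innerSL ℝ w)
  rw [innerSL_apply_apply] at h
  refine h.congr_fun fun j => ?_
  rw [map_smul, hX, innerSL_apply_apply, inner_smul_right, inner_smul_right, b.repr_apply_apply,
    real_inner_comm w (b j)]
  ring

lemma aux_var_le (b : HilbertBasis ι ℝ H) (X : H →L[ℝ] H) (c : ι → ℝ) (hc : ∀ j, 0 ≤ c j)
    (hX : ∀ j, X (b j) = c j • b j) (v w : H) {s : ℝ} (hs : 0 < s) :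
    2 * ⟪v, w⟫ - ⟪w, X w⟫ - s * ‖w‖ ^ 2 ≤ ∑' j, ⟪v, b j⟫ ^ 2 / (c j + s) := by
  have h1 := ((b.hasSum_inner_mul_inner v w).mul_left 2).sub (aux_hasSum_quad b X c hX w)
  have h2 := h1.sub ((aux_hasSum_sq b w).mul_left s)
  have h3 := aux_summable_div (fun j => ⟪v, b j⟫ ^ 2) c (fun j => sq_nonneg _) hc
    (aux_hasSum_sq b v).summable hs
  refine hasSum_le (fun j => ?_) h2 h3.hasSum
  have hp : 0 < c j + s := by linarith [hc j]
  rw [le_div_iff₀ hp, real_inner_comm w (b j)]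
  nlinarith [sq_nonneg (⟪v, b j⟫ - (c j + s) * ⟪w, b j⟫)]

lemma aux_var_eq (b : HilbertBasis ι ℝ H) (X : H →L[ℝ] H) (c : ι → ℝ) (hc : ∀ j, 0 ≤ c j)
    (hX : ∀ j, X (b j) = c j • b j) (v : H) {s : ℝ} (hs : 0 < s) :
    ∃ w : H, 2 * ⟪v, w⟫ - ⟪w, X w⟫ - s * ‖w‖ ^ 2 = ∑' j, ⟪v, b j⟫ ^ 2 / (c j + s) := by
  have hmem : Memℓp (fun j => ⟪v, b j⟫ / (c j + s)) 2 := by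
    refine memℓp_gen ?_
    have : Summable (fun j => ⟪v, b j⟫ ^ 2 / s ^ 2) := (aux_hasSum_sq b v).summable.div_const _
    refine Summable.of_nonneg_of_le (fun j => by positivity) (fun j => ?_) this
    have hp : 0 < c j + s := by linarith [hc j]
    simp only [ENNReal.toReal_ofNat, Real.rpow_ofNat, Real.norm_eq_abs, sq_abs, div_pow]
    exact div_le_div_of_nonneg_left (sq_nonneg _) (by positivity)
      (pow_le_pow_left₀ hs.le (by linarith [hc j]) 2)
  refine ⟨b.repr.symm ⟨_, hmem⟩, ?_⟩
  set w := b.repr.symm ⟨_, hmem⟩ with hw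
  have hwj : ∀ j, ⟪w, b j⟫ = ⟪v, b j⟫ / (c j + s) := by
    intro j
    rw [real_inner_comm, ← b.repr_apply_apply, hw, LinearIsometryEquiv.apply_symm_apply]
  have h1 := ((b.hasSum_inner_mul_inner v w).mul_left 2).sub (aux_hasSum_quad b X c hX w)
  have h2 := h1.sub ((aux_hasSum_sq b w).mul_left s)
  rw [← h2.tsum_eq]
  refine tsum_congr fun j => ?_
  have hp : c j + s ≠ 0 := by linarith [hc j]
  rw [real_inner_comm w (b j), hwj]
  field_simp
  ring

/-- Convexity of the resolvent along a segment towards `A`, at an eigenvector of `A`. -/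
lemma aux_resolvent (f b1 b2 : HilbertBasis ι ℝ H) (A X1 X2 : H →L[ℝ] H) (l c1 c2 : ι → ℝ)
    (hl : ∀ j, 0 ≤ l j) (hc1 : ∀ j, 0 ≤ c1 j) (hc2 : ∀ j, 0 ≤ c2 j)
    (hA : ∀ j, A (f j) = l j • f j) (h1 : ∀ j, X1 (b1 j) = c1 j • b1 j)
    (h2 : ∀ j, X2 (b2 j) = c2 j • b2 j) (t : ℝ) (ht0 : 0 ≤ t) (ht1 : t ≤ 1)
    (hX : X2 = (1 - t) • X1 + t • A) (i : ι) {s : ℝ} (hs : 0 < s) :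
    ∑' j, ⟪f i, b2 j⟫ ^ 2 / (c2 j + s) ≤
      (1 - t) * ∑' j, ⟪f i, b1 j⟫ ^ 2 / (c1 j + s) + t * (1 / (l i + s)) := by
  classical
  obtain ⟨w, hw⟩ := aux_var_eq b2 X2 c2 hc2 h2 (f i) hs
  have e1 := aux_var_le b1 X1 c1 hc1 h1 (f i) w hs
  have e2 := aux_var_le f A l hl hA (f i) w hs
  have e3 : ∑' j, ⟪f i, f j⟫ ^ 2 / (l j + s) = 1 / (l i + s) := by
    rw [tsum_eq_single i]
    · rw [real_inner_self_eq_norm_sq, f.orthonormal.1]; norm_num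
    · intro j hj
      rw [f.orthonormal.2 hj.symm]; simp
  rw [e3] at e2
  have e4 : ⟪w, X2 w⟫ = (1 - t) * ⟪w, X1 w⟫ + t * ⟪w, A w⟫ := by
    rw [hX]; simp [inner_add_right, inner_smul_right]
  rw [← hw, e4]
  have m1 := mul_le_mul_of_nonneg_left e1 (by linarith : 0 ≤ 1 - t)
  have m2 := mul_le_mul_of_nonneg_left e2 ht0
  linarith
end spec

/-! Covariance operator -/

section cov
variable {d : ℕ} {H : Type*} [NormedAddCommGroup H] [InnerProductSpace ℝ H] [CompleteSpace H]
  {ι : Type*}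

lemma aux_cov_integrable (φ : EuclideanSpace ℝ (Fin d) → H) (hφc : Continuous φ)
    (hn : ∀ x, ‖φ x‖ = 1) (p : Measure (EuclideanSpace ℝ (Fin d))) [IsProbabilityMeasure p] :
    Integrable (fun x => rankOne (φ x) (φ x)) p := by
  have hc : Continuous (fun x => rankOne (φ x) (φ x)) := by
    have h : Continuous fun x => ContinuousLinearMap.smulRightL ℝ H H (innerSL ℝ (φ x)) (φ x) := by
      fun_prop
    exact h
  refine Integrable.of_bound hc.aestronglyMeasurable 1 (Filter.Eventually.of_forall fun x => ?_)
  unfold rankOne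
  rw [ContinuousLinearMap.norm_smulRight_apply, innerSL_apply_norm, hn]
  norm_num

lemma aux_inner_cov (φ : EuclideanSpace ℝ (Fin d) → H) (hφc : Continuous φ)
    (hn : ∀ x, ‖φ x‖ = 1) (p : Measure (EuclideanSpace ℝ (Fin d))) [IsProbabilityMeasure p]
    (u v : H) : ⟪u, covOp φ p v⟫ = ∫ x, ⟪u, φ x⟫ * ⟪v, φ x⟫ ∂p := by
  have hi := aux_cov_integrable φ hφc hn p
  unfold covOp
  rw [ContinuousLinearMap.integral_apply hi,
    ← integral_inner (hi.apply_continuousLinearMap v)]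
  refine integral_congr_ae (Filter.Eventually.of_forall fun x => ?_)
  simp only [rankOne, ContinuousLinearMap.smulRight_apply, innerSL_apply_apply, inner_smul_right]
  rw [real_inner_comm v (φ x)]
  ring

lemma aux_sq_integrable (φ : EuclideanSpace ℝ (Fin d) → H) (hφc : Continuous φ)
    (hn : ∀ x, ‖φ x‖ = 1) (p : Measure (EuclideanSpace ℝ (Fin d))) [IsProbabilityMeasure p]
    (v : H) : Integrable (fun x => ⟪v, φ x⟫ ^ 2) p := by
  refine Integrable.of_bound (Continuous.aestronglyMeasurable (by fun_prop)) (‖v‖ ^ 2)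
    (Filter.Eventually.of_forall fun x => ?_)
  have h := abs_real_inner_le_norm v (φ x)
  rw [hn, mul_one] at h
  rw [norm_pow]
  exact pow_le_pow_left₀ (norm_nonneg _) h 2

lemma aux_trace (φ : EuclideanSpace ℝ (Fin d) → H) (hφc : Continuous φ)
    (hn : ∀ x, ‖φ x‖ = 1) (p : Measure (EuclideanSpace ℝ (Fin d))) [IsProbabilityMeasure p]
    (b : HilbertBasis ι ℝ H) : HasSum (fun j => ⟪b j, covOp φ p (b j)⟫) 1 := by
  have hsq : ∀ x, HasSum (fun j => ⟪b j, φ x⟫ ^ 2) 1 := by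
    intro x
    have h := aux_hasSum_sq b (φ x)
    rw [hn] at h
    norm_num at h
    refine h.congr_fun fun j => ?_
    rw [real_inner_comm]
  set S : Set ι := ⋃ n : ℕ, Function.support
    (fun j => ⟪b j, φ (TopologicalSpace.denseSeq (EuclideanSpace ℝ (Fin d)) n)⟫ ^ 2) with hS
  have hSc : S.Countable := Set.countable_iUnion fun n => (hsq _).summable.countable_support
  have hSz : ∀ j, j ∉ S → ∀ x, ⟪b j, φ x⟫ = 0 := by
    intro j hj x
    have hd := TopologicalSpace.denseRange_denseSeq (EuclideanSpace ℝ (Fin d))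
    have : (fun x => ⟪b j, φ x⟫) = fun _ => (0:ℝ) := by
      refine hd.equalizer (by fun_prop) (by fun_prop) ?_
      ext n
      by_contra h
      exact hj (Set.mem_iUnion.2 ⟨n, by simpa using h⟩)
    exact congrFun this x
  have : Countable S := hSc.to_subtype
  have hsub : Function.support (fun j => ⟪b j, covOp φ p (b j)⟫) ⊆ S := by
    intro j hj
    by_contra h
    exact hj (by simp only [aux_inner_cov φ hφc hn, hSz j h]; simp)
  rw [← hasSum_subtype_iff_of_support_subset hsub]
  have hsqS : ∀ x, HasSum (fun j : S => ⟪b j, φ x⟫ ^ 2) 1 := by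
    intro x
    refine (hasSum_subtype_iff_of_support_subset (f := fun j => ⟪b j, φ x⟫ ^ 2) ?_).2 (hsq x)
    intro j hj
    by_contra h
    exact hj (by simp [hSz j h])
  have := hasSum_integral_of_dominated_convergence (μ := p)
    (F := fun (j : S) x => ⟪b j, φ x⟫ ^ 2) (f := fun _ => (1:ℝ))
    (fun (j : S) x => ⟪b j, φ x⟫ ^ 2)
    (fun j => (aux_sq_integrable φ hφc hn p (b j)).1)
    (fun j => Filter.Eventually.of_forall fun x => by simp)
    (Filter.Eventually.of_forall fun x => (hsqS x).summable)
    (by simp_rw [(hsqS _).tsum_eq]; exact integrable_const _)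
    (Filter.Eventually.of_forall fun x => hsqS x)
  simp only [integral_const, probReal_univ, smul_eq_mul, mul_one] at this
  refine this.congr_fun fun j => ?_
  simp only [Function.comp, aux_inner_cov φ hφc hn, sq]

/-- The kernel of the mixture is contained in the kernel of `Σ_p`. -/
lemma aux_ker (φ : EuclideanSpace ℝ (Fin d) → H) (hφc : Continuous φ)
    (hn : ∀ x, ‖φ x‖ = 1) (p q : Measure (EuclideanSpace ℝ (Fin d))) [IsProbabilityMeasure p]
    [IsProbabilityMeasure q] (hpq : p ≪ q) {α : ℝ} (hα : α ∈ Set.Icc (0:ℝ) 1) (u v : H) (l : ℝ)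
    (hl : 0 < l) (hu : covOp φ p u = l • u)
    (hv : (α • covOp φ p + (1 - α) • covOp φ q) v = 0) : ⟪u, v⟫ = 0 := by
  have hp0 : 0 ≤ ∫ x, ⟪v, φ x⟫ ^ 2 ∂p := integral_nonneg fun x => sq_nonneg _
  have hq0 : 0 ≤ ∫ x, ⟪v, φ x⟫ ^ 2 ∂q := integral_nonneg fun x => sq_nonneg _
  have h0 : α * ∫ x, ⟪v, φ x⟫ ^ 2 ∂p + (1 - α) * ∫ x, ⟪v, φ x⟫ ^ 2 ∂q = 0 := by
    have := congrArg (fun y => ⟪v, y⟫) hv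
    simpa [inner_add_right, inner_smul_right, aux_inner_cov φ hφc hn, ← sq] using this
  have hae : ∀ᵐ x ∂p, ⟪v, φ x⟫ = 0 := by
    rcases hα.2.eq_or_lt with h | h
    · have hz : ∫ x, ⟪v, φ x⟫ ^ 2 ∂p = 0 := by rw [h] at h0; linarith
      rw [integral_eq_zero_iff_of_nonneg (fun x => sq_nonneg _)
        (aux_sq_integrable φ hφc hn p v)] at hz
      filter_upwards [hz] with x hx
      simpa using hx
    · have hz : ∫ x, ⟪v, φ x⟫ ^ 2 ∂q = 0 := by
        have := mul_nonneg hα.1 hp0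
        have h2 := mul_nonneg (sub_nonneg.2 h.le) hq0
        have : (1 - α) * ∫ x, ⟪v, φ x⟫ ^ 2 ∂q = 0 := by linarith
        rcases mul_eq_zero.1 this with h' | h'
        · linarith
        · exact h'
      rw [integral_eq_zero_iff_of_nonneg (fun x => sq_nonneg _)
        (aux_sq_integrable φ hφc hn q v)] at hz
      have hz' : ∀ᵐ x ∂q, ⟪v, φ x⟫ = 0 := by
        filter_upwards [hz] with x hx
        simpa using hx
      exact hpq.ae_le hz'
  have h1 : ⟪v, covOp φ p u⟫ = 0 := by
    rw [aux_inner_cov φ hφc hn]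
    refine integral_eq_zero_of_ae ?_
    filter_upwards [hae] with x hx
    simp [hx]
  rw [hu, inner_smul_right] at h1
  rw [real_inner_comm]
  exact (mul_eq_zero.1 h1).resolve_left hl.ne'

end cov

/-- Klein inequality. -/
lemma aux_klein {H : Type*} [NormedAddCommGroup H] [InnerProductSpace ℝ H] {ι : Type*}
    (f g : HilbertBasis ι ℝ H) (l c : ι → ℝ) (hl : ∀ i, 0 ≤ l i) (hc : ∀ j, 0 ≤ c j)
    (hsl : HasSum l 1) (hsc : HasSum c 1)
    (hz : ∀ i j, 0 < l i → c j = 0 → ⟪f i, g j⟫ = 0)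
    (hS : Summable (fun ij : ι × ι =>
      l ij.1 * Real.log (l ij.1 / c ij.2) * ⟪f ij.1, g ij.2⟫ ^ 2)) :
    0 ≤ ∑' ij : ι × ι, l ij.1 * Real.log (l ij.1 / c ij.2) * ⟪f ij.1, g ij.2⟫ ^ 2 := by
  have hrow : ∀ i, HasSum (fun j => ⟪f i, g j⟫ ^ 2) 1 := by
    intro i
    have h := aux_hasSum_sq g (f i)
    rw [f.orthonormal.1] at h
    simpa using h
  have hcol : ∀ j, HasSum (fun i => ⟪f i, g j⟫ ^ 2) 1 := by
    intro j
    have h := aux_hasSum_sq f (g j)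
    rw [g.orthonormal.1] at h
    norm_num at h
    refine h.congr_fun fun i => ?_
    rw [real_inner_comm]
  have key : ∀ (l : ι → ℝ) (W : ι → ι → ℝ), (∀ i, 0 ≤ l i) → (∀ i j, 0 ≤ W i j) → HasSum l 1 →
      (∀ i, HasSum (W i) 1) → HasSum (fun ij : ι × ι => l ij.1 * W ij.1 ij.2) 1 := by
    intro l W hl hW hsl hr
    have hr' : ∀ i, HasSum (fun j => l i * W i j) (l i) := fun i => by
      simpa using (hr i).mul_left (l i)
    have hsm : Summable (fun ij : ι × ι => l ij.1 * W ij.1 ij.2) := by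
      rw [summable_prod_of_nonneg (fun ij => mul_nonneg (hl _) (hW _ _))]
      refine ⟨fun i => (hr' i).summable, ?_⟩
      simp_rw [(hr' _).tsum_eq]
      exact hsl.summable
    have := hsm.hasSum.prod_fiberwise hr'
    have h2 := hsm.hasSum
    rwa [this.unique hsl] at h2
  have k1 := key l (fun i j => ⟪f i, g j⟫ ^ 2) hl (fun i j => sq_nonneg _) hsl hrow
  have k2 := key c (fun j i => ⟪f i, g j⟫ ^ 2) hc (fun i j => sq_nonneg _) hsc hcol
  have k2' : HasSum (fun ij : ι × ι => c ij.2 * ⟪f ij.1, g ij.2⟫ ^ 2) 1 := by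
    have := (Equiv.prodComm ι ι).hasSum_iff.2 k2
    exact this
  have k3 := k1.sub k2'
  rw [sub_self] at k3
  refine hasSum_le (fun ij => ?_) k3 hS.hasSum
  obtain ⟨i, j⟩ := ij
  simp only
  rw [← sub_mul]
  rcases (hl i).eq_or_lt with h | h
  · rw [← h]
    simp only [zero_sub, zero_mul]
    have := mul_nonneg (hc j) (sq_nonneg ⟪f i, g j⟫)
    linarith
  · rcases (hc j).eq_or_lt with h' | h'
    · rw [hz i j h h'.symm]; simp
    · refine mul_le_mul_of_nonneg_right ?_ (sq_nonneg _)
      have := Real.one_sub_inv_le_log_of_pos (div_pos h h')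
      have h3 := mul_le_mul_of_nonneg_left this h.le
      rw [inv_div] at h3
      have e : l i * (1 - c j / l i) = l i - c j := by field_simp
      linarith

/-- **Monotonicity of the regularized kernel KL divergence in the skewing parameter.**
If `p ≪ q`, then `α ↦ KKL_α(p‖q)` is decreasing on `[0,1]`, where
`KKL_α(p‖q) = Tr(Σ_p log Σ_p) - Tr(Σ_p log((1-α)Σ_q + αΣ_p))`, expressed through
spectral decompositions `(lam i, f i)` of `Σ_p` and `(gam α j, g α j)` of
`αΣ_p + (1-α)Σ_q` as `∑_{i,j} lam i · log(lam i / gam α j) · ⟪f i, g α j⟫²`. -/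
theorem kkl_alpha_antitone {d : ℕ} {H : Type*} [NormedAddCommGroup H]
    [InnerProductSpace ℝ H] [CompleteSpace H]
    (k : EuclideanSpace ℝ (Fin d) → EuclideanSpace ℝ (Fin d) → ℝ)
    (φ : EuclideanSpace ℝ (Fin d) → H) (hφc : Continuous φ)
    (hk : ∀ x y, k x y = ⟪φ x, φ y⟫) (hk1 : ∀ x, k x x = 1)
    (p q : Measure (EuclideanSpace ℝ (Fin d)))
    [IsProbabilityMeasure p] [IsProbabilityMeasure q]
    (hpq : p ≪ q)
    {ι : Type*} (f : HilbertBasis ι ℝ H) (lam : ι → ℝ)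
    (hf : ∀ i, covOp φ p (f i) = lam i • f i) (hlam : ∀ i, 0 ≤ lam i)
    (g : ℝ → HilbertBasis ι ℝ H) (gam : ℝ → ι → ℝ)
    (hg : ∀ α ∈ Set.Icc (0 : ℝ) 1, ∀ j,
      (α • covOp φ p + (1 - α) • covOp φ q) (g α j) = gam α j • g α j)
    (hgam : ∀ α ∈ Set.Icc (0 : ℝ) 1, ∀ j, 0 ≤ gam α j)
    (hsum : ∀ α ∈ Set.Icc (0 : ℝ) 1, Summable (fun ij : ι × ι =>
      lam ij.1 * Real.log (lam ij.1 / gam α ij.2) * ⟪(f ij.1 : H), (g α ij.2 : H)⟫ ^ 2)) :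
    AntitoneOn (fun α => ∑' ij : ι × ι,
        lam ij.1 * Real.log (lam ij.1 / gam α ij.2) * ⟪(f ij.1 : H), (g α ij.2 : H)⟫ ^ 2)
      (Set.Icc 0 1) := by
  have hn : ∀ x, ‖φ x‖ = 1 := by
    intro x
    have h := hk x x
    rw [hk1, real_inner_self_eq_norm_sq] at h
    have h0 := norm_nonneg (φ x)
    nlinarith
  have hker : ∀ α ∈ Set.Icc (0:ℝ) 1, ∀ i j, 0 < lam i → gam α j = 0 →
      ⟪(f i : H), (g α j : H)⟫ = 0 := by
    intro α hα i j hi hj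
    refine aux_ker φ hφc hn p q hpq hα (f i) (g α j) (lam i) hi (hf i) ?_
    rw [hg α hα j, hj, zero_smul]
  have htrf : HasSum lam 1 := by
    refine (aux_trace φ hφc hn p f).congr_fun fun i => ?_
    rw [hf, inner_smul_right, real_inner_self_eq_norm_sq, f.orthonormal.1]; norm_num
  have htrg : ∀ α ∈ Set.Icc (0:ℝ) 1, HasSum (gam α) 1 := by
    intro α hα
    have h := ((aux_trace φ hφc hn p (g α)).mul_left α).add
      ((aux_trace φ hφc hn q (g α)).mul_left (1 - α))
    have e : α * 1 + (1 - α) * 1 = 1 := by ring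
    rw [e] at h
    refine h.congr_fun fun j => ?_
    have h2 := congrArg (fun y => ⟪(g α j : H), y⟫) (hg α hα j)
    simp only [ContinuousLinearMap.add_apply, ContinuousLinearMap.smul_apply, inner_add_right,
      inner_smul_right, real_inner_self_eq_norm_sq, (g α).orthonormal.1] at h2
    rw [h2]; norm_num
  have hrow : ∀ α i, HasSum (fun j => ⟪(f i : H), (g α j : H)⟫ ^ 2) 1 := by
    intro α i
    have h := aux_hasSum_sq (g α) (f i)
    rw [f.orthonormal.1] at h
    simpa using h
  intro α hα β hβ hαβ
  simp only
  rcases hα.2.eq_or_lt with h1 | h1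
  · have : β = α := le_antisymm (by rw [h1]; exact hβ.2) hαβ
    rw [this]
  have hpos : 0 < 1 - α := by linarith
  set t : ℝ := (β - α) / (1 - α) with ht
  have ht0 : 0 ≤ t := div_nonneg (by linarith) hpos.le
  have ht1 : t ≤ 1 := (div_le_one hpos).2 (by linarith [hβ.2])
  have htm : t * (1 - α) = β - α := div_mul_cancel₀ _ hpos.ne'
  have hX : β • covOp φ p + (1 - β) • covOp φ q =
      (1 - t) • (α • covOp φ p + (1 - α) • covOp φ q) + t • covOp φ p := by
    have e1 : β = (1 - t) * α + t := by linarith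
    have e2 : 1 - β = (1 - t) * (1 - α) := by linarith
    rw [smul_add, smul_smul, smul_smul, ← e2, add_right_comm, ← add_smul, ← e1]
  have hklein := aux_klein f (g α) lam (gam α) hlam (hgam α hα) htrf (htrg α hα) (hker α hα)
    (hsum α hα)
  have hrowle : ∀ i,
      ∑' j, lam i * Real.log (lam i / gam β j) * ⟪(f i : H), (g β j : H)⟫ ^ 2 ≤
      (1 - t) * ∑' j, lam i * Real.log (lam i / gam α j) * ⟪(f i : H), (g α j : H)⟫ ^ 2 := by
    intro i
    rcases (hlam i).eq_or_lt with h | h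
    · simp [← h]
    · have hs : ∀ a ∈ Set.Icc (0:ℝ) 1, Summable (fun j =>
          Real.log (lam i / gam a j) * ⟪(f i : H), (g a j : H)⟫ ^ 2) := by
        intro a ha
        have := (hsum a ha).prod_factor i
        simp only [mul_assoc] at this
        exact (summable_mul_left_iff h.ne').1 this
      have hk := aux_key (fun j => ⟪(f i : H), (g α j : H)⟫ ^ 2)
        (fun j => ⟪(f i : H), (g β j : H)⟫ ^ 2) (gam α) (gam β) (lam i) t h ht1
        (fun j => sq_nonneg _) (fun j => sq_nonneg _) (hgam α hα) (hgam β hβ)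
        (hrow α i) (hrow β i)
        (fun j hj => by simp [hker α hα i j h hj]) (fun j hj => by simp [hker β hβ i j h hj])
        (hs α hα) (hs β hβ)
        (fun s hs => aux_resolvent f (g α) (g β) _ _ _ lam (gam α) (gam β) hlam (hgam α hα)
          (hgam β hβ) hf (hg α hα) (hg β hβ) t ht0 ht1 hX i hs)
      simp only [mul_assoc, tsum_mul_left]
      have := mul_le_mul_of_nonneg_left hk h.le
      linarith
  have hle : ∑' ij : ι × ι, lam ij.1 * Real.log (lam ij.1 / gam β ij.2) *
        ⟪(f ij.1 : H), (g β ij.2 : H)⟫ ^ 2 ≤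
      (1 - t) * ∑' ij : ι × ι, lam ij.1 * Real.log (lam ij.1 / gam α ij.2) *
        ⟪(f ij.1 : H), (g α ij.2 : H)⟫ ^ 2 := by
    rw [(hsum α hα).tsum_prod, (hsum β hβ).tsum_prod, ← tsum_mul_left]
    exact (hsum β hβ).prod.tsum_le_tsum hrowle ((hsum α hα).prod.mul_left _)
  nlinarith [mul_nonneg ht0 hklein]
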